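/- Let q ≥ 2 be an integer and λ₀, B₀ > 0. Let f₀ : ℝ × ℝ → ℝ be smooth, 1-periodic in its first argument, and suppose that for every natural number m and all nonnegative integers a, b with a + b = m, one has (1 + |v|)^q · |∂_x^a ∂_v^b f₀(x, v)| ≤ B₀ · m! / λ₀^m for all (x, v). Let C_* := ∫_ℝ (1 + |v|)^{−q} dv. Then for every integer k and every real η, the mixed Fourier transform satisfies | ∫₀¹ ∫_ℝ f₀(x, v) e^{−2πi (k x + η v)} dv dx | ≤ 2 C_* B₀ · e^{−π λ₀ |η|}. -/

import Mathlib

open MeasureTheory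

open scoped FourierTransform in
lemma aux_one_dim (q : ℕ) (hq : 2 ≤ q) (lam₀ B₀ : ℝ) (hlam₀ : 0 < lam₀)
    (g : ℝ → ℝ) (hg : ContDiff ℝ (⊤ : ℕ∞) g)
    (hb : ∀ (m : ℕ) (v : ℝ), (1 + |v|) ^ q * |iteratedDeriv m g v|
      ≤ B₀ * (Nat.factorial m : ℝ) / lam₀ ^ m) (η : ℝ) :
    ‖𝓕 (fun v => (g v : ℂ)) η‖ ≤
      2 * (∫ v : ℝ, (1 + |v|) ^ (-(q : ℤ))) * B₀ * Real.exp (-(Real.pi * lam₀ * |η|)) := by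
  set C := ∫ v : ℝ, (1 + |v|) ^ (-(q : ℤ)) with hCdef
  have hI : Integrable (fun v : ℝ => (1 + |v|) ^ (-(q : ℤ))) := by
    have h := integrable_one_add_norm (E := ℝ) (μ := volume) (r := (q : ℝ))
      (by simp; exact_mod_cast (by omega : 1 < q))
    refine h.congr (Filter.Eventually.of_forall fun v => ?_)
    simp only [Real.norm_eq_abs]
    rw [← Real.rpow_intCast]
    simp
  have hGit : ∀ m : ℕ, iteratedDeriv m (fun v => (g v : ℂ)) =
      fun v => ((iteratedDeriv m g v : ℝ) : ℂ) := by
    intro m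
    induction m with
    | zero => simp
    | succ m ih =>
      rw [iteratedDeriv_succ, ih]
      funext v
      have hd : DifferentiableAt ℝ (iteratedDeriv m g) v :=
        (hg.differentiable_iteratedDeriv m (by exact_mod_cast WithTop.coe_lt_top m)) v
      rw [hd.hasDerivAt.ofReal_comp.deriv, iteratedDeriv_succ]
  have hG : ContDiff ℝ (⊤ : ℕ∞) (fun v => (g v : ℂ)) :=
    Complex.ofRealCLM.contDiff.comp hg
  have hpt : ∀ (m : ℕ) (v : ℝ), ‖iteratedDeriv m (fun v => (g v : ℂ)) v‖ ≤
      (B₀ * (Nat.factorial m : ℝ) / lam₀ ^ m) * (1 + |v|) ^ (-(q : ℤ)) := by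
    intro m v
    rw [hGit, Complex.norm_real, Real.norm_eq_abs, zpow_neg, zpow_natCast, ← div_eq_mul_inv,
      le_div_iff₀ (by positivity), mul_comm]
    exact hb m v
  have hint : ∀ m : ℕ, Integrable (iteratedDeriv m (fun v => (g v : ℂ))) := by
    intro m
    refine (hI.const_mul (B₀ * (Nat.factorial m : ℝ) / lam₀ ^ m)).mono' ?_
      (Filter.Eventually.of_forall (hpt m))
    exact (hG.continuous_iteratedDeriv m (by exact_mod_cast le_top)).aestronglyMeasurable
  set F := ‖𝓕 (fun v => (g v : ℂ)) η‖ with hF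
  set t := Real.pi * lam₀ * |η| with ht
  have key : ∀ m : ℕ, t ^ m / (Nat.factorial m : ℝ) * F ≤ C * B₀ * (1 / 2) ^ m := by
    intro m
    have h1 := congrFun (Real.fourier_iteratedDeriv (N := ⊤) (n := m) hG
      (fun n _ => hint n) le_top) η
    have h2 : ‖𝓕 (iteratedDeriv m (fun v => (g v : ℂ))) η‖ ≤
        (B₀ * (Nat.factorial m : ℝ) / lam₀ ^ m) * C := by
      rw [hCdef, ← integral_const_mul, Real.fourier_real_eq_integral_exp_smul]
      refine norm_integral_le_of_norm_le (hI.const_mul _) (Filter.Eventually.of_forall fun v => ?_)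
      rw [norm_smul, Complex.norm_exp_ofReal_mul_I, one_mul]
      exact hpt m v
    rw [h1, norm_smul, norm_pow] at h2
    have h3 : ‖(2 * Real.pi * Complex.I * η : ℂ)‖ = 2 * Real.pi * |η| := by
      simp [abs_of_pos Real.pi_pos]
    rw [h3, ← hF] at h2
    have hf : (0 : ℝ) < (Nat.factorial m : ℝ) := by positivity
    have h4 := mul_le_mul_of_nonneg_left h2
      (show 0 ≤ lam₀ ^ m / (Nat.factorial m : ℝ) * (1 / 2) ^ m by positivity)
    calc t ^ m / (Nat.factorial m : ℝ) * F
        = lam₀ ^ m / (Nat.factorial m : ℝ) * (1 / 2) ^ m * ((2 * Real.pi * |η|) ^ m * F) := by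
          have : t = lam₀ * (1 / 2) * (2 * Real.pi * |η|) := by rw [ht]; ring
          rw [this, mul_pow, mul_pow]; ring
      _ ≤ _ := h4
      _ = C * B₀ * (1 / 2) ^ m := by field_simp
  have hs1 : HasSum (fun m : ℕ => t ^ m / (Nat.factorial m : ℝ) * F) (Real.exp t * F) := by
    have := NormedSpace.expSeries_div_hasSum_exp t
    rw [← Real.exp_eq_exp_ℝ] at this
    exact this.mul_right F
  have hs2 : HasSum (fun m : ℕ => C * B₀ * (1 / 2 : ℝ) ^ m) (C * B₀ * 2) :=
    hasSum_geometric_two.mul_left _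
  have h := hasSum_le key hs1 hs2
  rw [Real.exp_neg, ← div_eq_mul_inv, le_div_iff₀ (Real.exp_pos _)]
  linarith

/-- Exponential decay of the mixed Fourier transform in the velocity
frequency: under the analytic-norm bound
`(1+|v|)^q |∂_x^a ∂_v^b f₀| ≤ B₀ m!/lam₀^m` for `a + b = m`, the mixed Fourier
transform satisfies `|f̂₀(k, η)| ≤ 2 C_* B₀ e^{-π lam₀ |η|}` where
`C_* = ∫ (1+|v|)^{-q} dv`. -/
theorem mixed_fourier_exponential_decay (q : ℕ) (hq : 2 ≤ q)
    (lam₀ B₀ : ℝ) (hlam₀ : 0 < lam₀) (hB₀ : 0 < B₀)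
    (f₀ : ℝ × ℝ → ℝ) (hsmooth : ContDiff ℝ (⊤ : ℕ∞) f₀)
    (hper : ∀ x v : ℝ, f₀ (x + 1, v) = f₀ (x, v))
    (hbound : ∀ m a b : ℕ, a + b = m → ∀ x v : ℝ,
      (1 + |v|) ^ q *
        |iteratedDeriv a (fun x' => iteratedDeriv b (fun v' => f₀ (x', v')) v) x|
          ≤ B₀ * (Nat.factorial m : ℝ) / lam₀ ^ m)
    (Cstar : ℝ) (hC : Cstar = ∫ v : ℝ, (1 + |v|) ^ (-(q : ℤ)))
    (k : ℤ) (η : ℝ) :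
    ‖∫ x in Set.Ico (0:ℝ) 1, ∫ v : ℝ, (f₀ (x, v) : ℂ) *
        Complex.exp (-(2 * Real.pi * Complex.I *
          ((k : ℂ) * (x : ℂ) + (η : ℂ) * (v : ℂ))))‖
      ≤ 2 * Cstar * B₀ * Real.exp (-(Real.pi * lam₀ * |η|)) := by
  have hx : ∀ x : ℝ, ‖∫ v : ℝ, (f₀ (x, v) : ℂ) *
        Complex.exp (-(2 * Real.pi * Complex.I *
          ((k : ℂ) * (x : ℂ) + (η : ℂ) * (v : ℂ))))‖
      ≤ 2 * Cstar * B₀ * Real.exp (-(Real.pi * lam₀ * |η|)) := by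
    intro x
    have h := aux_one_dim q hq lam₀ B₀ hlam₀ (fun v => f₀ (x, v))
      (hsmooth.comp (contDiff_const.prodMk contDiff_id))
      (fun m v => by simpa using hbound m 0 m (by simp) x v) η
    rw [← hC, Real.fourier_real_eq_integral_exp_smul] at h
    refine le_trans (le_of_eq ?_) h
    have e : ∀ v : ℝ, (f₀ (x, v) : ℂ) * Complex.exp (-(2 * Real.pi * Complex.I *
          ((k : ℂ) * (x : ℂ) + (η : ℂ) * (v : ℂ)))) =
        Complex.exp (((-2 * Real.pi * k * x : ℝ) : ℂ) * Complex.I) *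
          (Complex.exp (((-2 * Real.pi * v * η : ℝ) : ℂ) * Complex.I) • (f₀ (x, v) : ℂ)) := by
      intro v
      rw [smul_eq_mul, ← mul_assoc, ← Complex.exp_add, mul_comm]
      congr 2
      push_cast
      ring
    simp_rw [e]
    rw [integral_const_mul, norm_mul, Complex.norm_exp_ofReal_mul_I, one_mul]
  have h := norm_setIntegral_le_of_norm_le_const (μ := volume) (s := Set.Ico (0:ℝ) 1)
    (by simp) (fun x _ => hx x)
  simpa using h
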